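/- Let M, N, m, n be positive integers with m ≤ M, n ≤ N, and fix A ⊆ Fin M with card A = m and B ⊆ Fin N with card B = n. Let S ⊆ ℤ be a finite set, w : S → ℝ with w_k ≥ 0 and ∑_{k∈S} w_k² = 1/2, σ : S → ℝ with σ_k > 0, ε > 0, and means θ_{ij,k} ∈ ℝ with θ_{ij,k} = 0 whenever (i,j) ∉ A × B. Let P be the product over (i,j,k) of Gaussian measures with mean θ_{ij,k} and variance ε²σ_k², let t_{ij}(x) = ∑_{k∈S} w_k ((x_{ij,k}/(εσ_k))² − 1), and let t^{scan}(x) = max over all A' ⊆ Fin M with card A' = m and B' ⊆ Fin N with card B' = n of (mn)^{−1/2} ∑_{(i,j)∈A'×B'} t_{ij}(x). Suppose a > 0 is such that ∑_{k∈S} w_k θ_{ij,k}²/(ε²σ_k²) ≥ a for every (i,j) ∈ A × B, and set μ = ∫ (mn)^{−1/2} ∑_{(i,j)∈A×B} t_{ij} dP. Then μ ≥ a√(mn), and for every K with 0 < K < μ, P( { x : t^{scan}(x) ≤ K } ) ≤ ( 1 + 4(max_{k∈S} w_k)·μ/√(mn) ) / (μ − K)². -/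

import Mathlib

open MeasureTheory ProbabilityTheory
open scoped BigOperators

/-- The fourth moment of a real Gaussian distribution. -/
lemma integral_pow_four_gaussianReal (μ : ℝ) (v : NNReal) :
    ∫ x, x ^ 4 ∂gaussianReal μ v = μ ^ 4 + 6 * μ ^ 2 * v + 3 * (v : ℝ) ^ 2 := by
  have hs (t : ℝ) : HasDerivAt (fun t : ℝ ↦ μ + v * t) v t := by
    simpa using ((hasDerivAt_id t).const_mul (v : ℝ)).const_add μ
  have he (t : ℝ) : HasDerivAt (fun t : ℝ ↦ Real.exp (μ * t + v * t ^ 2 / 2))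
      (Real.exp (μ * t + v * t ^ 2 / 2) * (μ + v * t)) t := by
    refine HasDerivAt.exp ?_
    convert! ((hasDerivAt_id t).const_mul μ).add
      ((((hasDerivAt_id t).pow 2).const_mul (v : ℝ)).div_const 2) using 1
    simp only [id]
    ring
  have h1 : deriv (fun t : ℝ ↦ Real.exp (μ * t + v * t ^ 2 / 2)) =
      fun t ↦ Real.exp (μ * t + v * t ^ 2 / 2) * (μ + v * t) :=
    funext fun t ↦ (he t).deriv
  have h2 : deriv (fun t : ℝ ↦ Real.exp (μ * t + v * t ^ 2 / 2) * (μ + v * t)) =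
      fun t ↦ Real.exp (μ * t + v * t ^ 2 / 2) * ((μ + v * t) ^ 2 + v) := by
    funext t
    rw [((he t).fun_mul (hs t)).deriv]
    ring
  have h3 : deriv (fun t : ℝ ↦ Real.exp (μ * t + v * t ^ 2 / 2) * ((μ + v * t) ^ 2 + v)) =
      fun t ↦ Real.exp (μ * t + v * t ^ 2 / 2) * ((μ + v * t) ^ 3 + 3 * v * (μ + v * t)) := by
    funext t
    rw [((he t).fun_mul (((hs t).fun_pow 2).add_const (v : ℝ))).deriv]
    push_cast
    ring
  have h4 : deriv (fun t : ℝ ↦ Real.exp (μ * t + v * t ^ 2 / 2) *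
        ((μ + v * t) ^ 3 + 3 * v * (μ + v * t))) =
      fun t ↦ Real.exp (μ * t + v * t ^ 2 / 2) *
        ((μ + v * t) ^ 4 + 6 * v * (μ + v * t) ^ 2 + 3 * (v : ℝ) ^ 2) := by
    funext t
    rw [((he t).fun_mul (((hs t).fun_pow 3).fun_add ((hs t).const_mul (3 * (v : ℝ))))).deriv]
    push_cast
    ring
  have key := iteratedDeriv_mgf_zero (X := id) (μ := gaussianReal μ v)
    (by simp [integrableExpSet_id_gaussianReal]) 4
  rw [mgf_id_gaussianReal] at key
  simp only [iteratedDeriv_succ, iteratedDeriv_zero, h1, h2, h3, h4] at key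
  simp only [Pi.pow_apply, id] at key
  rw [← key]
  simp
  ring

/-- The second moment of a real Gaussian distribution. -/
lemma integral_sq_gaussianReal (μ : ℝ) (v : NNReal) :
    ∫ x, x ^ 2 ∂gaussianReal μ v = μ ^ 2 + v := by
  have h := variance_eq_sub (memLp_id_gaussianReal (μ := μ) (v := v) 2)
  simp only [variance_id_gaussianReal, Pi.pow_apply, id, integral_id_gaussianReal] at h
  linarith

lemma memLp_sq_gaussianReal (μ : ℝ) (v : NNReal) :
    MemLp (fun x ↦ x ^ 2) 2 (gaussianReal μ v) := by
  rw [memLp_two_iff_integrable_sq (by fun_prop)]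
  have h := (memLp_id_gaussianReal (μ := μ) (v := v) 4).integrable_norm_pow (by norm_num)
  refine h.congr (.of_forall fun x ↦ ?_)
  simp only [id, Real.norm_eq_abs]
  rw [← pow_mul, Even.pow_abs (by decide)]

lemma variance_sq_gaussianReal (μ : ℝ) (v : NNReal) :
    Var[fun x ↦ x ^ 2; gaussianReal μ v] = 4 * μ ^ 2 * v + 2 * (v : ℝ) ^ 2 := by
  rw [variance_eq_sub (memLp_sq_gaussianReal μ v), integral_sq_gaussianReal]
  have h : ∫ x, ((fun x : ℝ ↦ x ^ 2) ^ 2) x ∂gaussianReal μ v = ∫ x, x ^ 4 ∂gaussianReal μ v := by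
    simp [← pow_mul]
  rw [h, integral_pow_four_gaussianReal]
  ring

lemma memLp_standardized_sq_gaussianReal (μ : ℝ) (v : NNReal) (b : ℝ) :
    MemLp (fun x ↦ b * (x ^ 2 / v - 1)) 2 (gaussianReal μ v) := by
  simpa [div_eq_mul_inv] using
    (((memLp_sq_gaussianReal μ v).mul_const (v : ℝ)⁻¹).sub (memLp_const 1)).const_mul b

lemma integral_standardized_sq_gaussianReal (μ : ℝ) {v : NNReal} (hv : v ≠ 0) (b : ℝ) :
    ∫ x, b * (x ^ 2 / v - 1) ∂gaussianReal μ v = b * (μ ^ 2 / v) := by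
  have hv' : (v : ℝ) ≠ 0 := by exact_mod_cast hv
  rw [integral_const_mul, integral_sub
    (((memLp_sq_gaussianReal μ v).integrable (by norm_num)).div_const _) (integrable_const 1),
    integral_div, integral_sq_gaussianReal]
  simp
  field_simp
  simp

lemma variance_standardized_sq_gaussianReal (μ : ℝ) {v : NNReal} (hv : v ≠ 0) (b : ℝ) :
    Var[fun x ↦ b * (x ^ 2 / v - 1); gaussianReal μ v] = b ^ 2 * (2 + 4 * (μ ^ 2 / v)) := by
  have hv' : (v : ℝ) ≠ 0 := by exact_mod_cast hv
  have h : (fun x : ℝ ↦ b * (x ^ 2 / v - 1)) = fun x ↦ b / v * x ^ 2 - b := by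
    funext x
    ring
  rw [h, variance_sub_const (by fun_prop), variance_const_mul, variance_sq_gaussianReal]
  field_simp
  ring

section GaussianProduct

variable {ι : Type*} [Fintype ι] (μ : ι → ℝ) (v : ι → NNReal) (s : Finset ι) (b : ι → ℝ)

lemma memLp_standardized_sq_pi_gaussianReal (i : ι) :
    MemLp (fun x ↦ b i * (x i ^ 2 / v i - 1)) 2
      (Measure.pi fun i ↦ gaussianReal (μ i) (v i)) :=
  (memLp_standardized_sq_gaussianReal (μ i) (v i) (b i)).comp_measurePreserving
    (measurePreserving_eval (fun i ↦ gaussianReal (μ i) (v i)) i)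

lemma memLp_sum_standardized_sq_pi_gaussianReal :
    MemLp (fun x ↦ ∑ i ∈ s, b i * (x i ^ 2 / v i - 1)) 2
      (Measure.pi fun i ↦ gaussianReal (μ i) (v i)) :=
  memLp_finsetSum s fun i _ ↦ memLp_standardized_sq_pi_gaussianReal μ v b i

lemma integral_sum_standardized_sq_pi_gaussianReal (hv : ∀ i, v i ≠ 0) :
    ∫ x, ∑ i ∈ s, b i * (x i ^ 2 / v i - 1) ∂(Measure.pi fun i ↦ gaussianReal (μ i) (v i)) =
      ∑ i ∈ s, b i * (μ i ^ 2 / v i) := by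
  have hp (i : ι) := measurePreserving_eval (fun i ↦ gaussianReal (μ i) (v i)) i
  rw [integral_finsetSum s fun i _ ↦
    (memLp_standardized_sq_pi_gaussianReal μ v b i).integrable (by norm_num)]
  refine Finset.sum_congr rfl fun i _ ↦ ?_
  rw [← integral_standardized_sq_gaussianReal (μ i) (hv i) (b i), ← (hp i).map_eq,
    integral_map (hp i).measurable.aemeasurable (by fun_prop)]

lemma variance_sum_standardized_sq_pi_gaussianReal (hv : ∀ i, v i ≠ 0) :
    Var[fun x ↦ ∑ i ∈ s, b i * (x i ^ 2 / v i - 1);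
        Measure.pi fun i ↦ gaussianReal (μ i) (v i)] =
      ∑ i ∈ s, b i ^ 2 * (2 + 4 * (μ i ^ 2 / v i)) := by
  have hp (i : ι) := measurePreserving_eval (fun i ↦ gaussianReal (μ i) (v i)) i
  have hL (i : ι) := memLp_standardized_sq_gaussianReal (μ i) (v i) (b i)
  have hsum : (fun x : ι → ℝ ↦ ∑ i ∈ s, b i * (x i ^ 2 / v i - 1)) =
      ∑ i ∈ s, fun x ↦ b i * (x i ^ 2 / v i - 1) := by
    ext x
    simp
  rw [hsum, IndepFun.variance_sum (fun i _ ↦ memLp_standardized_sq_pi_gaussianReal μ v b i)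
    (fun i _ j _ hij ↦
      (iIndepFun_pi fun i ↦ (hL i).aestronglyMeasurable.aemeasurable).indepFun hij)]
  refine Finset.sum_congr rfl fun i _ ↦ ?_
  rw [← variance_standardized_sq_gaussianReal (μ i) (hv i) (b i), ← (hp i).map_eq,
    variance_map (by fun_prop) (hp i).measurable.aemeasurable]
  rfl

end GaussianProduct

/-- A one-sided form of Chebyshev's inequality for the lower tail. -/
lemma meas_le_le_variance_div_sq {Ω : Type*} [MeasurableSpace Ω] {P : Measure Ω}
    [IsFiniteMeasure P] {X : Ω → ℝ} (hX : MemLp X 2 P) {K : ℝ} (hK : K < ∫ x, X x ∂P) :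
    P {x | X x ≤ K} ≤ ENNReal.ofReal (Var[X; P] / (∫ x, X x ∂P - K) ^ 2) := by
  refine (measure_mono fun x (hx : X x ≤ K) ↦ ?_).trans
    (meas_ge_le_variance_div_sq hX (sub_pos.2 hK))
  rw [Set.mem_ofPred_eq, abs_sub_comm]
  exact (sub_le_sub_left hx _).trans (le_abs_self _)

/-- Non-asymptotic type II error bound for the scan test (proof of Theorem 3.1, part 2):
`μ := E[(mn)^{-1/2} ∑_{A×B} t_{ij}] ≥ a√(mn)` and for `0 < K < μ`,
`P(t^{scan} ≤ K) ≤ (1 + 4(max_k w_k)μ/√(mn))/(μ-K)²`.  The event `{t^{scan} ≤ K}`,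
where `t^{scan}` is the maximum over all `m×n` submatrices, is written as the set where
all the standardized submatrix sums are `≤ K`. -/
theorem scan_test_type_II_bound
    (M N m n : ℕ) (hM : 0 < M) (hN : 0 < N) (hm : 0 < m) (hn : 0 < n)
    (hmM : m ≤ M) (hnN : n ≤ N)
    (A : Finset (Fin M)) (hA : A.card = m) (B : Finset (Fin N)) (hB : B.card = n)
    (S : Finset ℤ) (w σ : ℤ → ℝ)
    (hw0 : ∀ k ∈ S, 0 ≤ w k) (hw2 : ∑ k ∈ S, (w k) ^ 2 = 1 / 2)
    (hσ : ∀ k ∈ S, 0 < σ k) (ε : ℝ) (hε : 0 < ε)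
    (θ : Fin M → Fin N → ℤ → ℝ)
    (hθ0 : ∀ i j k, ¬(i ∈ A ∧ j ∈ B) → θ i j k = 0)
    (P : Measure (Fin M × Fin N × S → ℝ))
    (hP : P = Measure.pi fun p : Fin M × Fin N × S =>
      gaussianReal (θ p.1 p.2.1 p.2.2) (Real.toNNReal (ε ^ 2 * (σ p.2.2) ^ 2)))
    (t : Fin M → Fin N → (Fin M × Fin N × S → ℝ) → ℝ)
    (ht : t = fun i j x => ∑ k : S, w k * ((x (i, j, k) / (ε * σ k)) ^ 2 - 1))
    (a : ℝ) (ha : 0 < a)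
    (hamean : ∀ i ∈ A, ∀ j ∈ B,
      a ≤ ∑ k : S, w k * (θ i j k) ^ 2 / (ε ^ 2 * (σ k) ^ 2))
    (μ : ℝ)
    (hμ : μ = ∫ x, ((m : ℝ) * n) ^ (-(1 / 2) : ℝ) * ∑ p ∈ A ×ˢ B, t p.1 p.2 x ∂P) :
    a * Real.sqrt ((m : ℝ) * n) ≤ μ ∧
    ∀ K : ℝ, 0 < K → K < μ →
      P {x | ∀ A' : Finset (Fin M), A'.card = m → ∀ B' : Finset (Fin N), B'.card = n →
          ((m : ℝ) * n) ^ (-(1 / 2) : ℝ) * ∑ p ∈ A' ×ˢ B', t p.1 p.2 x ≤ K}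
        ≤ ENNReal.ofReal
            ((1 + 4 * (⨆ k : S, w k) * μ / Real.sqrt ((m : ℝ) * n)) / (μ - K) ^ 2) := by
  have hmn : (0 : ℝ) < (m : ℝ) * n := by positivity
  set r := Real.sqrt ((m : ℝ) * n) with hr
  have hrpos : 0 < r := Real.sqrt_pos.2 hmn
  have hrr : r * r = (m : ℝ) * n := Real.mul_self_sqrt hmn.le
  have hc : ((m : ℝ) * n) ^ (-(1 / 2) : ℝ) = r⁻¹ := by
    rw [Real.rpow_neg hmn.le, hr, Real.sqrt_eq_rpow]
  have hcard : ((A ×ˢ B).card : ℝ) = r * r := by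
    rw [Finset.card_product, hA, hB, hrr]
    push_cast
    rfl
  rw [hc] at hμ ⊢
  have hvk (k : S) : ((Real.toNNReal (ε ^ 2 * σ k ^ 2) : NNReal) : ℝ) = ε ^ 2 * σ k ^ 2 :=
    Real.coe_toNNReal _ (by positivity)
  let v : Fin M × Fin N × S → NNReal := fun q ↦ Real.toNNReal (ε ^ 2 * σ q.2.2 ^ 2)
  have hv (q) : v q ≠ 0 := by
    have := hσ q.2.2 q.2.2.2
    have : 0 < ε ^ 2 * σ q.2.2 ^ 2 := by positivity
    simpa [v] using this
  let b : Fin M × Fin N × S → ℝ := fun q ↦ r⁻¹ * w q.2.2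
  let s : Finset (Fin M × Fin N × S) := A ×ˢ B ×ˢ Finset.univ
  let θ' : Fin M × Fin N × S → ℝ := fun q ↦ θ q.1 q.2.1 q.2.2
  have hsum (f : Fin M × Fin N × S → ℝ) :
      ∑ q ∈ s, f q = ∑ p ∈ A ×ˢ B, ∑ k : S, f (p.1, p.2, k) := by
    simp only [s, Finset.sum_product]
  have hT : (fun x ↦ r⁻¹ * ∑ p ∈ A ×ˢ B, t p.1 p.2 x) =
      fun x ↦ ∑ q ∈ s, b q * (x q ^ 2 / v q - 1) := by
    funext x
    simp only [hsum, ht, b, v, hvk, Finset.mul_sum, div_pow, mul_pow, mul_assoc]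
  have hX := memLp_sum_standardized_sq_pi_gaussianReal θ' v s b
  have hE := integral_sum_standardized_sq_pi_gaussianReal θ' v s b hv
  have hVar := variance_sum_standardized_sq_pi_gaussianReal θ' v s b hv
  change P = Measure.pi fun q ↦ gaussianReal (θ' q) (v q) at hP
  have : IsProbabilityMeasure P := by
    rw [hP]
    infer_instance
  rw [← hP, ← hT] at hX hVar
  rw [← hP, ← hT, ← hμ] at hE
  have hμsum : μ = r⁻¹ * ∑ p ∈ A ×ˢ B, ∑ k : S, w k * θ p.1 p.2 k ^ 2 / (ε ^ 2 * σ k ^ 2) := by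
    rw [hE, hsum]
    simp only [b, θ', v, hvk, Finset.mul_sum, mul_assoc, mul_div_assoc]
  have hw2' : ∑ k : S, w k ^ 2 = 1 / 2 := by
    rw [← hw2, Finset.sum_coe_sort S fun k ↦ w k ^ 2]
  refine ⟨?_, fun K _ hKμ ↦ ?_⟩
  · have h : (A ×ˢ B).card • a ≤
        ∑ p ∈ A ×ˢ B, ∑ k : S, w k * θ p.1 p.2 k ^ 2 / (ε ^ 2 * σ k ^ 2) :=
      Finset.card_nsmul_le_sum _ _ _ fun p hp ↦
        hamean p.1 (Finset.mem_product.1 hp).1 p.2 (Finset.mem_product.1 hp).2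
    rw [nsmul_eq_mul, hcard] at h
    rw [hμsum, inv_mul_eq_div, le_div_iff₀ hrpos]
    linarith
  · set W := ⨆ k : S, w k
    have hW (k : S) : w k ≤ W := le_ciSup (f := fun k : S ↦ w k) (Set.finite_range _).bddAbove k
    have hVle : Var[fun x ↦ r⁻¹ * ∑ p ∈ A ×ˢ B, t p.1 p.2 x; P] ≤ 1 + 4 * W * μ / r := by
      have hterm : ∀ q ∈ s, b q ^ 2 * (2 + 4 * (θ' q ^ 2 / v q)) ≤
          2 * b q ^ 2 + 4 * W / r * (b q * (θ' q ^ 2 / v q)) := by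
        intro q _
        have hw := hw0 q.2.2 q.2.2.2
        have hb : 0 ≤ b q := mul_nonneg (inv_nonneg.2 hrpos.le) hw
        have hbW : b q ≤ W / r := by
          rw [div_eq_inv_mul]
          exact mul_le_mul_of_nonneg_left (hW q.2.2) (inv_nonneg.2 hrpos.le)
        have hq : 0 ≤ b q * (θ' q ^ 2 / v q) := by positivity
        have := mul_le_mul_of_nonneg_right hbW hq
        calc b q ^ 2 * (2 + 4 * (θ' q ^ 2 / v q))
            = 2 * b q ^ 2 + 4 * (b q * (b q * (θ' q ^ 2 / v q))) := by ring
          _ ≤ 2 * b q ^ 2 + 4 * (W / r * (b q * (θ' q ^ 2 / v q))) := by linarith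
          _ = _ := by ring
      have hone : ∑ q ∈ s, 2 * b q ^ 2 = 1 := by
        rw [hsum]
        simp only [b, mul_pow, ← Finset.mul_sum, hw2', Finset.sum_const, nsmul_eq_mul, hcard]
        field_simp
      rw [hVar]
      refine (Finset.sum_le_sum hterm).trans_eq ?_
      rw [Finset.sum_add_distrib, hone, ← Finset.mul_sum, ← hE]
      ring
    have hcheb := meas_le_le_variance_div_sq hX (K := K) (hμ ▸ hKμ)
    rw [← hμ] at hcheb
    refine (measure_mono fun x hx ↦ Set.mem_ofPred_eq ▸ hx A hA B hB).trans (hcheb.trans ?_)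
    exact ENNReal.ofReal_le_ofReal (by gcongr)
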